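/- arXiv:1005.1424 — 3 statements merged into one kernel-verified Lean document; each statement's English description precedes it below -/
import Mathlib

section
/- If n is a finite nonempty type and A, B : Matrix n n ℝ≥0 commute under the max-product, then A and B have a common eigenvector: there exist u : n → ℝ≥0 with u ≠ 0 and scalars α, μ : ℝ≥0 such that A ⊗ u = α • u and B ⊗ u = μ • u. -/
open scoped NNReal

/-- Max-algebraic product of matrices over ℝ≥0. -/
noncomputable def maxMul {l m p : Type*} [Fintype m]
    (A : Matrix l m ℝ≥0) (B : Matrix m p ℝ≥0) : Matrix l p ℝ≥0 :=
  fun i k => ⨆ j, A i j * B j k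

/-- Max-algebraic action of a matrix on a vector over ℝ≥0. -/
noncomputable def maxVec {l m : Type*} [Fintype m]
    (A : Matrix l m ℝ≥0) (v : m → ℝ≥0) : l → ℝ≥0 :=
  fun i => ⨆ j, A i j * v j

open Filter Topology

/-- Maps of the nonnegative orthant that preserve binary suprema and nonnegative multiples. -/
structure IsMaxLinear {n : Type*} (f : (n → ℝ≥0) → (n → ℝ≥0)) : Prop where
  map_sup : ∀ u v, f (u ⊔ v) = f u ⊔ f v
  map_smul : ∀ (c : ℝ≥0) u, f (c • u) = c • f u

/-- Topologically closed max-algebraic subcones of the nonnegative orthant. -/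
structure IsClosedMaxCone {n : Type*} (V : Set (n → ℝ≥0)) : Prop where
  isClosed : IsClosed V
  sup_mem : ∀ u ∈ V, ∀ v ∈ V, u ⊔ v ∈ V
  smul_mem : ∀ (c : ℝ≥0), ∀ u ∈ V, c • u ∈ V

theorem NNReal.smul_pi_sup {n : Type*} (c : ℝ≥0) (u v : n → ℝ≥0) :
    c • (u ⊔ v) = c • u ⊔ c • v := by
  ext1 i
  simp [mul_max]

namespace IsMaxLinear

variable {n : Type*} {f : (n → ℝ≥0) → (n → ℝ≥0)}

theorem monotone (hf : IsMaxLinear f) : Monotone f := fun u v h => by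
  rw [← sup_eq_right, ← hf.map_sup, sup_eq_right.2 h]

theorem map_bot (hf : IsMaxLinear f) : f ⊥ = ⊥ := by
  have h := hf.map_smul 0 0
  rwa [zero_smul, zero_smul] at h

theorem smul (hf : IsMaxLinear f) (c : ℝ≥0) : IsMaxLinear (fun u => c • f u) where
  map_sup u v := by rw [hf.map_sup, NNReal.smul_pi_sup]
  map_smul a u := by rw [hf.map_smul, smul_comm]

theorem iterate_smul (hf : IsMaxLinear f) (c : ℝ≥0) (m : ℕ) (u : n → ℝ≥0) :
    (fun u => c • f u)^[m] u = c ^ m • f^[m] u := by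
  induction m with
  | zero => simp
  | succ m ih =>
    rw [Function.iterate_succ_apply', ih, Function.iterate_succ_apply', hf.map_smul, smul_smul,
      pow_succ']

/-- If an iterate of `f` does not increase `y`, the supremum of a stretch of its orbit is a
vector that `f` itself does not increase. -/
theorem exists_map_le (hf : IsMaxLinear f) {V : Set (n → ℝ≥0)} (hV : IsClosedMaxCone V)
    (hfV : Set.MapsTo f V V) {y : n → ℝ≥0} (hy : y ∈ V) {m : ℕ} (hm : f^[m + 1] y ≤ y) :
    ∃ v ∈ V, y ≤ v ∧ f v ≤ v := by
  refine ⟨(Finset.range (m + 1)).sup fun k => f^[k] y, ?_, ?_, ?_⟩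
  · have h0 := hV.smul_mem 0 y hy
    rw [zero_smul] at h0
    exact Finset.sup_induction h0 hV.sup_mem fun k _ =>
      hfV.iterate k hy
  · exact Finset.le_sup (f := fun k => f^[k] y) (Finset.mem_range.2 m.succ_pos)
  · rw [Finset.apply_sup_eq_sup_comp f hf.map_sup hf.map_bot]
    refine Finset.sup_le fun k hk => ?_
    rw [Function.comp_apply, ← Function.iterate_succ_apply' f]
    rcases (Nat.lt_succ_iff.1 (Finset.mem_range.1 hk)).eq_or_lt with rfl | hlt
    · exact hm.trans (Finset.le_sup (f := fun k => f^[k] y) (Finset.mem_range.2 k.succ_pos))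
    · exact Finset.le_sup (f := fun k => f^[k] y) (Finset.mem_range.2 (Nat.succ_lt_succ hlt))

/-- A vector of maximal support in an invariant cone is a super-eigenvector. -/
theorem exists_map_le_smul [Fintype n] {V : Set (n → ℝ≥0)}
    (hV : IsClosedMaxCone V) (hfV : Set.MapsTo f V V) (hne : ∃ v ∈ V, v ≠ 0) :
    ∃ u ∈ V, u ≠ 0 ∧ ∃ c : ℝ≥0, f u ≤ c • u := by
  obtain ⟨x, hx, hx0⟩ := hne
  obtain ⟨S, hSx, ⟨⟨y, hy, rfl⟩, hmax⟩⟩ :=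
    (Set.toFinite (Function.support '' V)).exists_le_maximal ⟨x, hx, rfl⟩
  have hsupp : ∀ i, y i = 0 → f y i = 0 := by
    intro i hi
    by_contra hfi
    have hsub : Function.support (y ⊔ f y) ⊆ Function.support y :=
      hmax ⟨_, hV.sup_mem y hy _ (hfV hy), rfl⟩ fun j hj => by
        simp only [Function.mem_support, Pi.sup_apply] at hj ⊢
        exact ((pos_iff_ne_zero.2 hj).trans_le le_sup_left).ne'
    refine hsub (a := i) ?_ hi
    simp only [Function.mem_support, Pi.sup_apply]
    exact ((pos_iff_ne_zero.2 hfi).trans_le le_sup_right).ne'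
  refine ⟨y, hy, ?_, Finset.univ.sup fun i => f y i / y i, fun i => ?_⟩
  · rintro rfl
    exact hx0 (by simpa using hSx)
  · by_cases hi : y i = 0
    · simp [hi, hsupp i hi]
    · rw [Pi.smul_apply, smul_eq_mul, ← div_le_iff₀ (pos_iff_ne_zero.2 hi)]
      exact Finset.le_sup (f := fun i => f y i / y i) (Finset.mem_univ i)

theorem exists_minimal_map_le_smul [Fintype n] (hf : IsMaxLinear f) (hfc : Continuous f)
    {V : Set (n → ℝ≥0)} (hV : IsClosedMaxCone V) (hfV : Set.MapsTo f V V)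
    (hne : ∃ v ∈ V, v ≠ 0) :
    ∃ u ∈ V, u ≠ 0 ∧ ∃ r : ℝ≥0, f u ≤ r • u ∧
      ∀ v ∈ V, v ≠ 0 → ∀ s : ℝ≥0, f v ≤ s • v → r ≤ s := by
  let N : (n → ℝ≥0) → ℝ≥0 := fun u => Finset.univ.sup u
  have hNc : Continuous N := Continuous.finset_sup_apply fun i _ => continuous_apply i
  have hle : ∀ u i, u i ≤ N u := fun u i => Finset.le_sup (f := u) (Finset.mem_univ i)
  have hN0 : ∀ u, u ≠ 0 → N u ≠ 0 := fun u hu h =>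
    hu (funext fun i => le_antisymm ((hle u i).trans h.le) zero_le)
  have hNmul : ∀ (c : ℝ≥0) u, N (c • u) = c * N u := fun c u =>
    (NNReal.mul_finset_sup c _ _).symm
  obtain ⟨y, hy, hy0, c, hc⟩ := exists_map_le_smul hV hfV hne
  let K : Set ((n → ℝ≥0) × ℝ≥0) :=
    Set.Icc (0, 0) (1, c) ∩ {p | p.1 ∈ V ∧ N p.1 = 1 ∧ f p.1 ≤ p.2 • p.1}
  have hK : IsCompact K := by
    refine isCompact_Icc.inter_right ?_
    exact (hV.isClosed.preimage continuous_fst).inter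
      ((isClosed_eq (hNc.comp continuous_fst) continuous_const).inter
        (isClosed_le (hfc.comp continuous_fst) (continuous_snd.smul continuous_fst)))
  have hmem : ∀ v ∈ V, v ≠ 0 → ∀ s ≤ c, f v ≤ s • v → ((N v)⁻¹ • v, s) ∈ K := by
    intro v hv hv0 s hs hfv
    have hN : N ((N v)⁻¹ • v) = 1 := by rw [hNmul, inv_mul_cancel₀ (hN0 v hv0)]
    refine ⟨⟨⟨fun i => zero_le, zero_le⟩, ⟨fun i => ?_, hs⟩⟩, hV.smul_mem _ v hv, hN, ?_⟩
    · exact (hle _ i).trans hN.le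
    · rw [hf.map_smul, smul_comm]
      exact fun i => mul_le_mul_right (hfv i) _
  obtain ⟨⟨u, r⟩, ⟨⟨-, -, hrc⟩, hu, hNu, hfu⟩, hmin⟩ :=
    hK.exists_isMinOn ⟨_, hmem y hy hy0 c le_rfl hc⟩ continuous_snd.continuousOn
  refine ⟨u, hu, ?_, r, hfu, fun v hv hv0 s hs => ?_⟩
  · rintro rfl
    have h : N (0 : n → ℝ≥0) = 0 := by simpa using hNmul 0 0
    exact zero_ne_one (h.symm.trans hNu)
  · rcases le_total s c with h | h
    · exact hmin (hmem v hv hv0 s h hs)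
    · exact hrc.trans h

/-- A descending orbit converges to a fixed point; if that point is zero, some iterate
halves the starting vector. -/
theorem exists_fixed_or_iterate_le [Finite n] (hf : IsMaxLinear f) (hfc : Continuous f)
    {V : Set (n → ℝ≥0)} (hV : IsClosedMaxCone V) (hfV : Set.MapsTo f V V)
    {y : n → ℝ≥0} (hy : y ∈ V) (hfy : f y ≤ y) :
    (∃ w ∈ V, w ≠ 0 ∧ f w = w) ∨ ∃ m, (2 : ℝ≥0) • f^[m + 1] y ≤ y := by
  have hanti : Antitone fun k => f^[k] y := hf.monotone.antitone_iterate_of_map_le hfy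
  let w : n → ℝ≥0 := fun i => ⨅ k, f^[k] y i
  have hlim : Tendsto (fun k => f^[k] y) atTop (𝓝 w) :=
    tendsto_pi_nhds.2 fun i =>
      tendsto_atTop_ciInf (fun a b hab => hanti hab i) (OrderBot.bddBelow _)
  by_cases hw : w = 0
  · right
    rw [hw] at hlim
    have hev : ∀ i, ∀ᶠ k in atTop, 2 * f^[k + 1] y i ≤ y i := by
      intro i
      rcases eq_or_ne (y i) 0 with hi | hi
      · refine Eventually.of_forall fun k => ?_
        have h : f^[k + 1] y i ≤ y i := hanti (Nat.zero_le (k + 1)) i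
        rw [hi] at h ⊢
        simp [le_antisymm h (zero_le)]
      · have h := (((tendsto_pi_nhds.1 hlim i).comp (tendsto_add_atTop_nat 1)).const_mul
          (2 : ℝ≥0))
        rw [Pi.zero_apply, mul_zero] at h
        exact (h.eventually_lt_const (pos_iff_ne_zero.2 hi)).mono fun k hk => hk.le
    obtain ⟨m, hm⟩ := (eventually_all.2 hev).exists
    exact ⟨m, hm⟩
  · exact Or.inl ⟨w, hV.isClosed.mem_of_tendsto hlim
      (Eventually.of_forall fun k => hfV.iterate k hy), hw,
      isFixedPt_of_tendsto_iterate hlim hfc.continuousAt⟩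

/-- A continuous max-linear self-map of a nonzero closed max-cone has an eigenvector in it. -/
theorem exists_eigenvector [Fintype n] (hf : IsMaxLinear f) (hfc : Continuous f)
    {V : Set (n → ℝ≥0)} (hV : IsClosedMaxCone V) (hfV : Set.MapsTo f V V)
    (hne : ∃ v ∈ V, v ≠ 0) :
    ∃ u ∈ V, u ≠ 0 ∧ ∃ r : ℝ≥0, f u = r • u := by
  obtain ⟨y, hy, hy0, r, hfy, hmin⟩ := hf.exists_minimal_map_le_smul hfc hV hfV hne
  rcases eq_or_ne r 0 with rfl | hr
  · refine ⟨y, hy, hy0, 0, le_antisymm hfy ?_⟩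
    rw [zero_smul]
    exact fun i => zero_le
  have hsmulV : ∀ c : ℝ≥0, Set.MapsTo (fun u => c • f u) V V :=
    fun c u hu => hV.smul_mem c _ (hfV hu)
  have hle_smul : ∀ c : ℝ≥0, c ≠ 0 → ∀ u v : n → ℝ≥0, c⁻¹ • u ≤ v ↔ u ≤ c • v :=
    fun c hc u v => forall_congr' fun i => inv_mul_le_iff₀ (pos_iff_ne_zero.2 hc)
  rcases (hf.smul r⁻¹).exists_fixed_or_iterate_le (by fun_prop) hV (hsmulV _) hy
    ((hle_smul r hr _ _).2 hfy) with ⟨w, hw, hw0, hfw⟩ | ⟨m, hm⟩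
  · exact ⟨w, hw, hw0, r, (inv_smul_eq_iff₀ hr).1 hfw⟩
  exfalso
  obtain ⟨c, hc⟩ : ∃ c : ℝ≥0, c ^ (m + 1) = 2 :=
    ⟨_, NNReal.rpow_inv_natCast_pow 2 m.succ_ne_zero⟩
  have hc1 : 1 < c := by
    by_contra! h
    exact absurd (hc ▸ pow_le_one₀ zero_le h : (2 : ℝ≥0) ≤ 1) (by norm_num)
  have hc0 : c ≠ 0 := (zero_lt_one.trans hc1).ne'
  obtain ⟨v, hv, hyv, hfv⟩ := (hf.smul (r * c⁻¹)⁻¹).exists_map_le hV (hsmulV _) hy (m := m) (by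
    rw [hf.iterate_smul] at hm ⊢
    rwa [mul_inv, inv_inv, mul_comm, mul_pow, mul_smul, hc])
  have hv0 : v ≠ 0 := by
    rintro rfl
    exact hy0 (le_antisymm hyv fun i => zero_le)
  have h := hmin v hv hv0 _ ((hle_smul _ (mul_ne_zero hr (inv_ne_zero hc0)) _ _).1 hfv)
  exact h.not_gt (mul_lt_of_lt_one_right (pos_iff_ne_zero.2 hr) (inv_lt_one_of_one_lt₀ hc1))

end IsMaxLinear

section MaxVec

variable {n : Type*} [Fintype n]

theorem maxVec_apply_eq_sup (A : Matrix n n ℝ≥0) (v : n → ℝ≥0) (i : n) :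
    maxVec A v i = Finset.univ.sup fun j => A i j * v j :=
  (Finset.sup_univ_eq_ciSup _).symm

theorem isMaxLinear_maxVec (A : Matrix n n ℝ≥0) : IsMaxLinear (maxVec A) where
  map_sup u v := by
    ext1 i
    simp only [maxVec_apply_eq_sup, Pi.sup_apply, ← Finset.sup_sup]
    congr 1
    ext1 j
    exact mul_max _ _ _
  map_smul c u := by
    ext1 i
    simp only [maxVec_apply_eq_sup, Pi.smul_apply, smul_eq_mul, NNReal.mul_finset_sup,
      mul_left_comm]

theorem continuous_maxVec (A : Matrix n n ℝ≥0) : Continuous (maxVec A) := by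
  refine continuous_pi fun i => ?_
  simp only [maxVec_apply_eq_sup]
  exact Continuous.finset_sup_apply fun j _ => continuous_const.mul (continuous_apply j)

theorem maxVec_maxVec (A B : Matrix n n ℝ≥0) (v : n → ℝ≥0) :
    maxVec A (maxVec B v) = maxVec (maxMul A B) v := by
  have hmul : ∀ i k, maxMul A B i k = Finset.univ.sup fun j => A i j * B j k :=
    fun i k => (Finset.sup_univ_eq_ciSup _).symm
  ext1 i
  simp only [maxVec_apply_eq_sup, hmul, NNReal.mul_finset_sup, NNReal.finset_sup_mul, mul_assoc]
  exact Finset.sup_comm _ _ _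

/-- The vectors satisfying the eigenvalue equation for a fixed scalar form a closed max-cone. -/
theorem isClosedMaxCone_eigen (A : Matrix n n ℝ≥0) (α : ℝ≥0) :
    IsClosedMaxCone {u | maxVec A u = α • u} where
  isClosed := isClosed_eq (continuous_maxVec A) (continuous_const_smul α)
  sup_mem u hu v hv := by
    simp only [Set.mem_ofPred_eq] at hu hv ⊢
    rw [(isMaxLinear_maxVec A).map_sup, hu, hv, NNReal.smul_pi_sup]
  smul_mem c u hu := by
    simp only [Set.mem_ofPred_eq] at hu ⊢
    rw [(isMaxLinear_maxVec A).map_smul, hu, smul_comm]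

end MaxVec

theorem commuting_have_common_eigenvector {n : Type*} [Fintype n] [Nonempty n]
    (A B : Matrix n n ℝ≥0) (hcomm : maxMul A B = maxMul B A) :
    ∃ (u : n → ℝ≥0) (α μ : ℝ≥0), u ≠ 0 ∧ maxVec A u = α • u ∧ maxVec B u = μ • u := by
  obtain ⟨x, -, hx0, α, hx⟩ := (isMaxLinear_maxVec A).exists_eigenvector (continuous_maxVec A)
    (V := Set.univ) ⟨isClosed_univ, fun _ _ _ _ => trivial, fun _ _ _ => trivial⟩
    (Set.mapsTo_univ _ _) ⟨1, trivial, one_ne_zero⟩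
  obtain ⟨u, hu, hu0, μ, hBu⟩ := (isMaxLinear_maxVec B).exists_eigenvector (continuous_maxVec B)
    (isClosedMaxCone_eigen A α)
    (fun v (hv : maxVec A v = α • v) => by
      rw [Set.mem_ofPred_eq, maxVec_maxVec, hcomm, ← maxVec_maxVec, hv,
        (isMaxLinear_maxVec B).map_smul]) ⟨x, hx, hx0⟩
  exact ⟨u, α, μ, hu0, hu, hBu⟩
end

section
/- Let r ≥ 1 and let Q : Fin r → Matrix n n ℝ≥0 be projectors under the max-product (Q i ⊗ Q i = Q i for all i) that commute in pairs (Q i ⊗ Q j = Q j ⊗ Q i for all i, j). Then the range of their ordered max-product equals the intersection of their ranges: { (Q 0 ⊗ Q 1 ⊗ ⋯ ⊗ Q (r-1)) ⊗ x | x : n → ℝ≥0 } = ⋂ i, { Q i ⊗ x | x : n → ℝ≥0 }. -/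
open scoped NNReal

/-- Ordered max-product of a list of square matrices (empty product = identity). -/
noncomputable def maxProdList {n : Type*} [Fintype n] [DecidableEq n]
    (l : List (Matrix n n ℝ≥0)) : Matrix n n ℝ≥0 :=
  l.foldr maxMul 1

lemma maxVec_maxMul {l m p : Type*} [Fintype m] [Fintype p]
    (A : Matrix l m ℝ≥0) (B : Matrix m p ℝ≥0) (x : p → ℝ≥0) :
    maxVec (maxMul A B) x = maxVec A (maxVec B x) := by
  funext i
  simp only [maxVec, maxMul, NNReal.iSup_mul, NNReal.mul_iSup, mul_assoc]
  apply le_antisymm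
  · refine ciSup_le' fun k => ciSup_le' fun j => ?_
    exact (le_ciSup (f := fun k => A i j * (B j k * x k)) (Set.finite_range _).bddAbove k).trans
      (le_ciSup (f := fun j => ⨆ k, A i j * (B j k * x k)) (Set.finite_range _).bddAbove j)
  · refine ciSup_le' fun j => ciSup_le' fun k => ?_
    exact (le_ciSup (f := fun j => A i j * (B j k * x k)) (Set.finite_range _).bddAbove j).trans
      (le_ciSup (f := fun k => ⨆ j, A i j * (B j k * x k)) (Set.finite_range _).bddAbove k)

lemma maxVec_one {n : Type*} [Fintype n] [DecidableEq n] (x : n → ℝ≥0) :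
    maxVec (1 : Matrix n n ℝ≥0) x = x := by
  funext i
  apply le_antisymm
  · refine ciSup_le' fun j => ?_
    obtain rfl | h := eq_or_ne i j
    · simp
    · simp [Matrix.one_apply_ne h]
  · simpa [maxVec] using
      le_ciSup (f := fun j => (1 : Matrix n n ℝ≥0) i j * x j) (Set.finite_range _).bddAbove i

/-- The range of a projector is its set of fixed vectors. -/
lemma exists_eq_maxVec_iff {n : Type*} [Fintype n] {P : Matrix n n ℝ≥0}
    (hP : maxMul P P = P) (v : n → ℝ≥0) : (∃ x, v = maxVec P x) ↔ maxVec P v = v := by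
  refine ⟨?_, fun h => ⟨v, h.symm⟩⟩
  rintro ⟨x, rfl⟩
  rw [← maxVec_maxMul, hP]

lemma maxVec_maxProdList_cons {n : Type*} [Fintype n] [DecidableEq n]
    (A : Matrix n n ℝ≥0) (l : List (Matrix n n ℝ≥0)) (x : n → ℝ≥0) :
    maxVec (maxProdList (A :: l)) x = maxVec A (maxVec (maxProdList l) x) :=
  maxVec_maxMul A (maxProdList l) x

lemma maxVec_maxProdList_of_fixed {n : Type*} [Fintype n] [DecidableEq n]
    {l : List (Matrix n n ℝ≥0)} {v : n → ℝ≥0} (h : ∀ A ∈ l, maxVec A v = v) :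
    maxVec (maxProdList l) v = v := by
  induction l with
  | nil => exact maxVec_one v
  | cons A l ih =>
    rw [maxVec_maxProdList_cons, ih fun B hB => h B (List.mem_cons_of_mem A hB),
      h A List.mem_cons_self]

/-- A projector that commutes with every factor of a product and is one of them fixes the range
of that product. -/
lemma maxVec_maxVec_maxProdList {n : Type*} [Fintype n] [DecidableEq n]
    {l : List (Matrix n n ℝ≥0)} {P : Matrix n n ℝ≥0} (hP : maxMul P P = P) (hPl : P ∈ l)
    (hcomm : ∀ A ∈ l, maxMul P A = maxMul A P) (x : n → ℝ≥0) :
    maxVec P (maxVec (maxProdList l) x) = maxVec (maxProdList l) x := by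
  induction l with
  | nil => simp at hPl
  | cons A l ih =>
    rw [maxVec_maxProdList_cons, ← maxVec_maxMul]
    rcases List.mem_cons.1 hPl with rfl | h
    · rw [hP]
    · rw [hcomm A List.mem_cons_self, maxVec_maxMul,
        ih h fun B hB => hcomm B (List.mem_cons_of_mem A hB)]

theorem range_of_product_of_commuting_projectors {n : Type*} [Fintype n] [DecidableEq n]
    {r : ℕ} (hr : 1 ≤ r) (Q : Fin r → Matrix n n ℝ≥0)
    (hproj : ∀ i, maxMul (Q i) (Q i) = Q i)
    (hcomm : ∀ i j, maxMul (Q i) (Q j) = maxMul (Q j) (Q i)) :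
    {v : n → ℝ≥0 | ∃ x, v = maxVec (maxProdList (List.ofFn Q)) x} =
      ⋂ i : Fin r, {v : n → ℝ≥0 | ∃ x, v = maxVec (Q i) x} := by
  ext v
  simp only [Set.mem_iInter, Set.mem_ofPred_eq, exists_eq_maxVec_iff (hproj _)]
  constructor
  · rintro ⟨x, rfl⟩ i
    refine maxVec_maxVec_maxProdList (hproj i) (List.mem_ofFn.2 ⟨i, rfl⟩) ?_ x
    rintro A hA
    obtain ⟨j, rfl⟩ := List.mem_ofFn.1 hA
    exact hcomm i j
  · refine fun h => ⟨v, (maxVec_maxProdList_of_fixed fun A hA => ?_).symm⟩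
    obtain ⟨j, rfl⟩ := List.mem_ofFn.1 hA
    exact h j
end

section
/- Let A, B : Matrix n n ℝ≥0 (n finite) have all entries ≤ 1 and commute under the max-product (A ⊗ B = B ⊗ A). Then the Boolean matrices A^[1] and B^[1] commute under the max-product: A^[1] ⊗ B^[1] = B^[1] ⊗ A^[1]. -/
open scoped NNReal Classical

/-- The Boolean (0/1) part of a matrix over ℝ≥0: entry `1` where `M i j = 1`, else `0`. -/
noncomputable def boolPart {n m : Type*} (M : Matrix n m ℝ≥0) : Matrix n m ℝ≥0 :=
  fun i j => if M i j = 1 then 1 else 0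

theorem boolPart_maxMul {l m p : Type*} [Fintype m]
    (A : Matrix l m ℝ≥0) (B : Matrix m p ℝ≥0)
    (hA : ∀ i j, A i j ≤ 1) (hB : ∀ j k, B j k ≤ 1) :
    boolPart (maxMul A B) = maxMul (boolPart A) (boolPart B) := by
  ext1 i k
  by_cases h : ∃ j, A i j = 1 ∧ B j k = 1
  · obtain ⟨j, hAj, hBj⟩ := h
    have : Nonempty m := ⟨j⟩
    have hAB : maxMul A B i k = 1 := by
      refine le_antisymm (ciSup_le fun j => mul_le_one' (hA i j) (hB j k)) ?_
      refine le_ciSup_of_le (Set.finite_range _).bddAbove j ?_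
      simp [hAj, hBj]
    have hbool : maxMul (boolPart A) (boolPart B) i k = 1 := by
      refine le_antisymm (ciSup_le fun j => mul_le_one' ?_ ?_) ?_
      · unfold boolPart; split_ifs <;> simp
      · unfold boolPart; split_ifs <;> simp
      · refine le_ciSup_of_le (Set.finite_range _).bddAbove j ?_
        simp [boolPart, hAj, hBj]
    rw [hbool, boolPart, if_pos hAB]
  · have hAB : maxMul A B i k ≠ 1 := by
      intro h1
      cases isEmpty_or_nonempty m with
      | inl _ => simp [maxMul] at h1
      | inr _ =>
        obtain ⟨j, hj⟩ := exists_eq_ciSup_of_finite (f := fun j => A i j * B j k)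
        have hprod : A i j * B j k = 1 := hj.trans h1
        refine h ⟨j, le_antisymm (hA i j) ?_, le_antisymm (hB j k) ?_⟩
        · exact hprod ▸ mul_le_of_le_one_right' (hB j k)
        · exact hprod ▸ mul_le_of_le_one_left' (hA i j)
    have hzero (j : m) : boolPart A i j * boolPart B j k = 0 := by
      have := not_exists.mp h j
      simp only [boolPart, mul_ite, mul_one, mul_zero]
      split_ifs <;> simp_all
    rw [boolPart, if_neg hAB]
    exact le_antisymm zero_le (ciSup_le' fun j => (hzero j).le)

theorem boolPart_commute {n : Type*} [Fintype n]
    (A B : Matrix n n ℝ≥0)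
    (hA : ∀ i j, A i j ≤ 1) (hB : ∀ i j, B i j ≤ 1)
    (hcomm : maxMul A B = maxMul B A) :
    maxMul (boolPart A) (boolPart B) = maxMul (boolPart B) (boolPart A) := by
  rw [← boolPart_maxMul A B hA hB, ← boolPart_maxMul B A hB hA, hcomm]
end
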